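/- Let F ∈ k[x₀,...,x₄] be a nonzero homogeneous polynomial of degree 3 such that the hypersurface Y = {F = 0} ⊂ ℙ⁴ has only finitely many singular points, and assume that no four pairwise distinct singular points of Y lie on a plane. Then the singular points of Y are in general position: for every d with 2 ≤ d ≤ 5, no d pairwise distinct singular points lie in a projective linear subspace of ℙ⁴ of dimension d − 2 (equivalently, any d ≤ 5 distinct singular points have representative vectors spanning a subspace of k⁵ of dimension d). -/

import Mathlib

open MvPolynomial

theorem aux_pderiv_comm {k : Type} [Field k] (i j : Fin 5) (F : MvPolynomial (Fin 5) k) :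
    pderiv i (pderiv j F) = pderiv j (pderiv i F) := by
  have h : ⁅(pderiv i : Derivation k (MvPolynomial (Fin 5) k) (MvPolynomial (Fin 5) k)),
      (pderiv j : Derivation k (MvPolynomial (Fin 5) k) (MvPolynomial (Fin 5) k))⁆ = 0 := by
    apply MvPolynomial.derivation_ext
    intro l
    rw [Derivation.commutator_apply]
    simp only [pderiv_X, Pi.single_apply]
    split_ifs <;> simp
  have h2 := congrArg (fun D => D F) h
  simp only [Derivation.commutator_apply] at h2
  exact sub_eq_zero.mp h2

theorem aux_euler {k : Type} [Field k] {n : ℕ} {G : MvPolynomial (Fin 5) k}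
    (h : G.IsHomogeneous n) (x : Fin 5 → k) :
    ∑ i, x i * eval x (pderiv i G) = n * eval x G := by
  have := congrArg (eval x) h.sum_X_mul_pderiv
  simpa using this

/-- The gradient of a cubic form comes from a symmetric trilinear form. -/
theorem aux_trilinear {k : Type} [Field k] [CharZero k]
    (F : MvPolynomial (Fin 5) k) (hhom : F.IsHomogeneous 3) :
    ∃ T : (Fin 5 → k) →ₗ[k] (Fin 5 → k) →ₗ[k] (Fin 5 → k) →ₗ[k] k,
      (∀ x y z, T x y z = T y x z) ∧ (∀ x y z, T x y z = T x z y) ∧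
      ∀ x, (∀ i, eval x (pderiv i F) = 0) ↔ T x x = 0 := by
  set c : Fin 5 → Fin 5 → Fin 5 → k :=
    fun i j l => coeff 0 (pderiv i (pderiv j (pderiv l F))) with hc
  have hc1 : ∀ i j l, c i j l = c j i l := fun i j l => by
    simp only [hc]; rw [aux_pderiv_comm]
  have hc2 : ∀ i j l, c i j l = c i l j := fun i j l => by
    simp only [hc]; rw [aux_pderiv_comm j l]
  have hce : ∀ i j l x, eval x (pderiv i (pderiv j (pderiv l F))) = c i j l := by
    intro i j l x
    have h0 : (pderiv i (pderiv j (pderiv l F))).IsHomogeneous 0 :=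
      hhom.pderiv.pderiv.pderiv
    rw [← totalDegree_zero_iff_isHomogeneous, totalDegree_eq_zero_iff_eq_C] at h0
    rw [h0]; simp [hc]
  have hq : ∀ l x, ∑ i, ∑ j, c i j l * x i * x j = 2 * eval x (pderiv l F) := by
    intro l x
    have h1 := aux_euler (hhom.pderiv (i := l)) x
    have h2 : ∀ j, ∑ i, x i * c i j l = eval x (pderiv j (pderiv l F)) := by
      intro j
      have := aux_euler ((hhom.pderiv (i := l)).pderiv (i := j)) x
      simpa [hce] using this
    norm_num at h1
    rw [← h1, Finset.sum_comm]
    refine Finset.sum_congr rfl fun j _ => ?_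
    rw [← h2, Finset.mul_sum]
    refine Finset.sum_congr rfl fun i _ => ?_
    ring
  let pr : Fin 5 → (Fin 5 → k) →ₗ[k] k := fun i => LinearMap.proj i
  let T : (Fin 5 → k) →ₗ[k] (Fin 5 → k) →ₗ[k] (Fin 5 → k) →ₗ[k] k :=
    ∑ i, ∑ j, ∑ l, c i j l • (pr i).smulRight ((pr j).smulRight (pr l))
  have hT : ∀ x y z, T x y z = ∑ i, ∑ j, ∑ l, c i j l * (x i * (y j * z l)) := by
    intro x y z
    simp [T, pr, LinearMap.sum_apply]
  refine ⟨T, ?_, ?_, ?_⟩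
  · intro x y z
    rw [hT, hT, Finset.sum_comm]
    refine Finset.sum_congr rfl fun j _ => Finset.sum_congr rfl fun i _ =>
      Finset.sum_congr rfl fun l _ => ?_
    rw [hc1]; ring
  · intro x y z
    rw [hT, hT]
    refine Finset.sum_congr rfl fun j _ => ?_
    rw [Finset.sum_comm]
    refine Finset.sum_congr rfl fun i _ =>
      Finset.sum_congr rfl fun l _ => ?_
    rw [hc2]; ring
  · intro x
    have key : ∀ z, T x x z = ∑ l, z l * (2 * eval x (pderiv l F)) := by
      intro z
      rw [hT]
      simp_rw [← hq, Finset.mul_sum]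
      rw [Finset.sum_comm]
      conv_rhs => rw [Finset.sum_comm]
      conv_rhs => enter [2, i]; rw [Finset.sum_comm]
      rw [Finset.sum_comm]
      refine Finset.sum_congr rfl fun j _ => Finset.sum_congr rfl fun i _ =>
        Finset.sum_congr rfl fun l _ => ?_
      ring
    constructor
    · intro h
      refine LinearMap.ext fun z => ?_
      simp [key, h]
    · intro h l
      have := key (Pi.single l 1)
      rw [h] at this
      simpa [Pi.single_apply] using this

/-- No one-parameter family of distinct singular points. -/
theorem aux_inf {k : Type} [Field k] [CharZero k] (F : MvPolynomial (Fin 5) k)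
    (T : (Fin 5 → k) →ₗ[k] (Fin 5 → k) →ₗ[k] (Fin 5 → k) →ₗ[k] k)
    (hT : ∀ x, (∀ i, eval x (pderiv i F) = 0) ↔ T x x = 0)
    (hfin : {x : Projectivization k (Fin 5 → k) |
        ∀ i, MvPolynomial.eval x.rep (MvPolynomial.pderiv i F) = 0}.Finite)
    (w : k → Fin 5 → k) (hw0 : ∀ t, w t ≠ 0) (hw : ∀ t, T (w t) (w t) = 0)
    (hinj : ∀ s t a : k, a • w t = w s → s = t) : False := by
  refine Set.infinite_of_injective_forall_mem (f := fun t => Projectivization.mk k (w t) (hw0 t))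
    ?_ ?_ hfin
  · intro s t h
    obtain ⟨a, ha⟩ := (Projectivization.mk_eq_mk_iff' k _ _ _ _).1 h
    exact hinj s t a ha
  · intro t
    obtain ⟨a, ha⟩ := Projectivization.exists_smul_eq_mk_rep k (w t) (hw0 t)
    change ∀ i, _
    rw [hT, ← ha]
    simp [Units.smul_def, hw]

/-- Two singular points: the chord contains no third one. -/
theorem aux_chord {k : Type} [Field k] [CharZero k] (F : MvPolynomial (Fin 5) k)
    (T : (Fin 5 → k) →ₗ[k] (Fin 5 → k) →ₗ[k] (Fin 5 → k) →ₗ[k] k)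
    (h12 : ∀ x y z, T x y z = T y x z)
    (hT : ∀ x, (∀ i, eval x (pderiv i F) = 0) ↔ T x x = 0)
    (hfin : {x : Projectivization k (Fin 5 → k) |
        ∀ i, MvPolynomial.eval x.rep (MvPolynomial.pderiv i F) = 0}.Finite)
    (p q : Fin 5 → k) (hli : LinearIndependent k ![p, q]) (hp : T p p = 0) (hq : T q q = 0)
    (a b : k) (ha : a ≠ 0) (hb : b ≠ 0)
    (hab : T (a • p + b • q) (a • p + b • q) = 0) : False := by
  rw [LinearIndependent.pair_iff] at hli
  have hpq : T p q = 0 := by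
    refine LinearMap.ext fun v => ?_
    have h := congrArg (fun f => f v) hab
    have h1 := h12 q p v
    simp only [map_add, map_smul, LinearMap.add_apply, LinearMap.smul_apply, hp, hq,
      LinearMap.zero_apply, smul_eq_mul, h1] at h
    have h2 : (2 * a * b) * T p q v = 0 := by linear_combination h
    simpa [ha, hb] using h2
  have hqp : T q p = 0 := LinearMap.ext fun v => by rw [h12, hpq]
  refine aux_inf F T hT hfin (fun t => p + t • q) ?_ ?_ ?_
  · intro t h
    have := hli 1 t (by simpa using h)
    simp at this
  · intro t
    simp [hp, hq, hpq, hqp]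
  · intro s t c h
    have := hli (c - 1) (c * t - s) (by
      have : c • (p + t • q) - (p + s • q) = 0 := sub_eq_zero.mpr h
      rw [← this]; module)
    obtain ⟨h1, h2⟩ := this
    have : c = 1 := by linear_combination h1
    subst this
    linear_combination -h2

theorem aux_quad {k : Type} [Field k] [IsAlgClosed k] [CharZero k] (A B C : k) :
    ∃ u v : k, (u ≠ 0 ∨ v ≠ 0) ∧ u * u * A + 2 * u * v * B + v * v * C = 0 := by
  by_cases hA : A = 0
  · exact ⟨1, 0, by simp, by simp [hA]⟩
  · obtain ⟨r, hr⟩ := IsAlgClosed.exists_pow_nat_eq (B * B - A * C) (n := 2) (by norm_num)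
    refine ⟨(r - B) / A, 1, by simp, ?_⟩
    field_simp
    linear_combination hr

/-- Five singular points in a hyperplane, no four coplanar. -/
theorem aux_five {k : Type} [Field k] [IsAlgClosed k] [CharZero k] (F : MvPolynomial (Fin 5) k)
    (T : (Fin 5 → k) →ₗ[k] (Fin 5 → k) →ₗ[k] (Fin 5 → k) →ₗ[k] k)
    (h12 : ∀ x y z, T x y z = T y x z) (h23 : ∀ x y z, T x y z = T x z y)
    (hT : ∀ x, (∀ i, eval x (pderiv i F) = 0) ↔ T x x = 0)
    (hfin : {x : Projectivization k (Fin 5 → k) |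
        ∀ i, MvPolynomial.eval x.rep (MvPolynomial.pderiv i F) = 0}.Finite)
    (p : Fin 4 → Fin 5 → k) (hli : LinearIndependent k p) (hp : ∀ i, T (p i) (p i) = 0)
    (a : Fin 4 → k) (ha : ∀ i, a i ≠ 0)
    (hab : T (∑ i, a i • p i) (∑ i, a i • p i) = 0) : False := by
  have hpp : ∀ i v, T (p i) (p i) v = 0 := fun i v => by rw [hp]; rfl
  have hpp2 : ∀ i v, T (p i) v (p i) = 0 := fun i v => by rw [h23, hpp]
  have hpp3 : ∀ i v, T v (p i) (p i) = 0 := fun i v => by rw [h12, hpp2]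
  have e (j : Fin 4) := congrArg (fun f => f (p j)) hab
  simp only [Fin.sum_univ_four, map_add, map_smul, LinearMap.add_apply, LinearMap.smul_apply,
      LinearMap.zero_apply, smul_eq_mul] at e
  -- sorted representatives
  have s012 := h23 (p 0) (p 2) (p 1)
  have s102 := h12 (p 1) (p 0) (p 2)
  have s120 := h23 (p 1) (p 2) (p 0)
  have s201 := h12 (p 2) (p 0) (p 1)
  have s210 := h23 (p 2) (p 1) (p 0)
  have s013 := h23 (p 0) (p 3) (p 1)
  have s103 := h12 (p 1) (p 0) (p 3)
  have s130 := h23 (p 1) (p 3) (p 0)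
  have s301 := h12 (p 3) (p 0) (p 1)
  have s310 := h23 (p 3) (p 1) (p 0)
  have s023 := h23 (p 0) (p 3) (p 2)
  have s203 := h12 (p 2) (p 0) (p 3)
  have s230 := h23 (p 2) (p 3) (p 0)
  have s302 := h12 (p 3) (p 0) (p 2)
  have s320 := h23 (p 3) (p 2) (p 0)
  have s123 := h23 (p 1) (p 3) (p 2)
  have s213 := h12 (p 2) (p 1) (p 3)
  have s231 := h23 (p 2) (p 3) (p 1)
  have s312 := h12 (p 3) (p 1) (p 2)
  have s321 := h23 (p 3) (p 2) (p 1)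
  have e0 := e 0
  have e1 := e 1
  have e2 := e 2
  have e3 := e 3
  have a0 := ha 0
  have a1 := ha 1
  have a2 := ha 2
  have a3 := ha 3
  simp only [hpp, hpp2, hpp3, s210, s310, s320, s321, s120, s130, s230, s231, s201, s301, s302,
    s312, s102, s103, s203, s213, s012, s013, s023, s123] at e0 e1 e2 e3
  set b3 := T (p 0) (p 1) (p 2)
  set b2 := T (p 0) (p 1) (p 3)
  set b1 := T (p 0) (p 2) (p 3)
  set b0 := T (p 1) (p 2) (p 3)
  have f0 : a 0 * a 1 * a 2 * b3 + a 0 * a 1 * a 3 * b2 + a 0 * a 2 * a 3 * b1 = 0 := by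
    linear_combination (a 0 / 2) * e0
  have f1 : a 0 * a 1 * a 2 * b3 + a 0 * a 1 * a 3 * b2 + a 1 * a 2 * a 3 * b0 = 0 := by
    linear_combination (a 1 / 2) * e1
  have f2 : a 0 * a 1 * a 2 * b3 + a 0 * a 2 * a 3 * b1 + a 1 * a 2 * a 3 * b0 = 0 := by
    linear_combination (a 2 / 2) * e2
  have f3 : a 0 * a 1 * a 3 * b2 + a 0 * a 2 * a 3 * b1 + a 1 * a 2 * a 3 * b0 = 0 := by
    linear_combination (a 3 / 2) * e3
  have hb0 : b0 = 0 := by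
    have : a 1 * a 2 * a 3 * b0 = 0 := by linear_combination (f1 + f2 + f3 - 2 * f0) / 3
    simpa [a0, a1, a2, a3] using this
  have hb1 : b1 = 0 := by
    have : a 0 * a 2 * a 3 * b1 = 0 := by linear_combination (f0 + f2 + f3 - 2 * f1) / 3
    simpa [a0, a1, a2, a3] using this
  have hb2 : b2 = 0 := by
    have : a 0 * a 1 * a 3 * b2 = 0 := by linear_combination (f0 + f1 + f3 - 2 * f2) / 3
    simpa [a0, a1, a2, a3] using this
  have hb3 : b3 = 0 := by
    have : a 0 * a 1 * a 2 * b3 = 0 := by linear_combination (f0 + f1 + f2 - 2 * f3) / 3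
    simpa [a0, a1, a2, a3] using this
  have hall : ∀ i j l, T (p i) (p j) (p l) = 0 := by
    intro i j l
    fin_cases i <;> fin_cases j <;> fin_cases l <;>
      simp only [Fin.zero_eta, Fin.mk_one, Fin.reduceFinMk, hpp, hpp2, hpp3,
        s210, s310, s320, s321, s120, s130, s230, s231, s201, s301, s302,
        s312, s102, s103, s203, s213, s012, s013, s023, s123] <;> assumption
  -- a transversal vector
  obtain ⟨v, hv⟩ : ∃ v, v ∉ Submodule.span k (Set.range p) := by
    by_contra! h
    have h1 : Submodule.span k (Set.range p) = ⊤ := by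
      ext x; simp [h x]
    have h2 := finrank_span_eq_card hli
    rw [h1] at h2
    simp at h2
  have hli5 : LinearIndependent k (Fin.snoc p v : Fin 5 → (Fin 5 → k)) :=
    linearIndependent_finSnoc.2 ⟨hli, hv⟩
  have htop := hli5.span_eq_top_of_card_eq_finrank' (by simp)
  have hsing : ∀ c : Fin 4 → k, T (∑ i, c i • p i) (∑ i, c i • p i) v = 0 →
      T (∑ i, c i • p i) (∑ i, c i • p i) = 0 := by
    intro c hc
    apply LinearMap.ext_on_range htop
    intro i
    refine Fin.lastCases ?_ (fun j => ?_) i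
    · simpa only [Fin.snoc_last, LinearMap.zero_apply] using hc
    · simp [hall, LinearMap.sum_apply]
  -- the pencil of lines
  have hex : ∀ t : k, ∃ u w : k, (u ≠ 0 ∨ w ≠ 0) ∧
      T (∑ i, ![u, t * u, w, t * w] i • p i) (∑ i, ![u, t * u, w, t * w] i • p i) = 0 := by
    intro t
    obtain ⟨u, w, h0, h⟩ := aux_quad (T (p 0 + t • p 1) (p 0 + t • p 1) v)
      (T (p 0 + t • p 1) (p 2 + t • p 3) v) (T (p 2 + t • p 3) (p 2 + t • p 3) v)
    refine ⟨u, w, h0, hsing _ ?_⟩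
    have hs := h12 (p 2 + t • p 3) (p 0 + t • p 1) v
    have he : ∑ i, ![u, t * u, w, t * w] i • p i = u • (p 0 + t • p 1) + w • (p 2 + t • p 3) := by
      simp [Fin.sum_univ_four]; module
    rw [he]
    generalize p 0 + t • p 1 = X at *
    generalize p 2 + t • p 3 = Y at *
    simp only [map_add, map_smul, LinearMap.add_apply, LinearMap.smul_apply, smul_eq_mul, hs]
    linear_combination h
  choose u w h0 hz using hex
  have hinj := Fintype.linearIndependent_iff.1 hli
  refine aux_inf F T hT hfin (fun t => ∑ i, ![u t, t * u t, w t, t * w t] i • p i) ?_ hz ?_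
  · intro t h
    have := hinj _ h
    have g0 := this 0
    have g2 := this 2
    simp at g0 g2
    rcases h0 t with h | h <;> contradiction
  · intro s t c h
    have := hinj (fun i => c * ![u t, t * u t, w t, t * w t] i - ![u s, s * u s, w s, s * w s] i) (by
      rw [← sub_eq_zero.mpr h, Finset.smul_sum, ← Finset.sum_sub_distrib]
      refine Finset.sum_congr rfl fun i _ => ?_
      module)
    have g0 := this 0
    have g1 := this 1
    have g2 := this 2
    have g3 := this 3
    simp at g0 g1 g2 g3
    rcases h0 s with h | h
    · have : (s - t) * u s = 0 := by linear_combination t * g0 - g1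
      exact sub_eq_zero.1 ((mul_eq_zero.1 this).resolve_right h)
    · have : (s - t) * w s = 0 := by linear_combination t * g2 - g3
      exact sub_eq_zero.1 ((mul_eq_zero.1 this).resolve_right h)

/-- If no four pairwise distinct singular points of the cubic threefold
`{F = 0} ⊂ ℙ⁴` (with finitely many singular points) lie on a plane, then the singular
points are in general position: for `2 ≤ d ≤ 5`, any `d` pairwise distinct singular
points have representative vectors spanning a subspace of `k⁵` of dimension `d`. -/
theorem stmt_2 {k : Type} [Field k] [IsAlgClosed k] [CharZero k]
    (F : MvPolynomial (Fin 5) k) (hF : F ≠ 0) (hhom : F.IsHomogeneous 3)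
    (hfin : {x : Projectivization k (Fin 5 → k) |
        ∀ i, MvPolynomial.eval x.rep (MvPolynomial.pderiv i F) = 0}.Finite)
    (hnofour : ¬ ∃ (W : Submodule k (Fin 5 → k)) (q : Fin 4 → (Fin 5 → k))
      (hq : ∀ i, q i ≠ 0),
      Module.finrank k W = 3 ∧ (∀ i, q i ∈ W) ∧
      (∀ i j, i ≠ j →
        Projectivization.mk k (q i) (hq i) ≠ Projectivization.mk k (q j) (hq j)) ∧
      (∀ i j, MvPolynomial.eval (q i) (MvPolynomial.pderiv j F) = 0)) :
    ∀ (d : ℕ), 2 ≤ d → d ≤ 5 →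
      ∀ (p : Fin d → (Fin 5 → k)) (hp : ∀ i, p i ≠ 0),
        (∀ i j, i ≠ j →
          Projectivization.mk k (p i) (hp i) ≠ Projectivization.mk k (p j) (hp j)) →
        (∀ i j, MvPolynomial.eval (p i) (MvPolynomial.pderiv j F) = 0) →
        Module.finrank k (Submodule.span k (Set.range p)) = d := by
  obtain ⟨T, h12, h23, hT⟩ := aux_trilinear F hhom
  -- pairs
  have hpair : ∀ (x y : Fin 5 → k) (hx : x ≠ 0) (hy : y ≠ 0),
      Projectivization.mk k x hx ≠ Projectivization.mk k y hy → LinearIndependent k ![x, y] := by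
    intro x y hx hy hne
    rw [LinearIndependent.pair_iff' hx]
    intro a h
    exact hne ((Projectivization.mk_eq_mk_iff' k _ _ _ _).2 ⟨a, h⟩ |>.symm)
  -- triples
  have htrip : ∀ (p : Fin 3 → (Fin 5 → k)) (hp : ∀ i, p i ≠ 0),
      (∀ i j, i ≠ j →
          Projectivization.mk k (p i) (hp i) ≠ Projectivization.mk k (p j) (hp j)) →
      (∀ i j, eval (p i) (pderiv j F) = 0) → LinearIndependent k p := by
    intro p hp hne hs
    have l01 := hpair _ _ (hp 0) (hp 1) (hne 0 1 (by decide))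
    have l02 := hpair _ _ (hp 0) (hp 2) (hne 0 2 (by decide))
    have l12 := hpair _ _ (hp 1) (hp 2) (hne 1 2 (by decide))
    rw [linearIndependent_finSucc']
    have hi : Fin.init p = ![p 0, p 1] := by
      ext i; fin_cases i <;> rfl
    rw [hi]
    refine ⟨l01, fun hmem => ?_⟩
    change p 2 ∈ _ at hmem
    rw [Matrix.range_cons, Matrix.range_cons, Matrix.range_empty, Set.union_empty,
      Set.singleton_union, Submodule.mem_span_pair] at hmem
    obtain ⟨a, b, h⟩ := hmem
    have h2 := (hT (p 2)).1 (hs 2)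
    rw [← h] at h2
    by_cases ha : a = 0
    · rw [LinearIndependent.pair_iff' (hp 1)] at l12
      exact l12 b (by simpa [ha] using h)
    by_cases hb : b = 0
    · rw [LinearIndependent.pair_iff' (hp 0)] at l02
      exact l02 a (by simpa [hb] using h)
    exact aux_chord F T h12 hT hfin _ _ l01 ((hT _).1 (hs 0)) ((hT _).1 (hs 1)) a b ha hb h2
  -- four points, one in the span of the three others
  have hquad : ∀ (p : Fin 3 → (Fin 5 → k)) (r : Fin 5 → k) (hp : ∀ i, p i ≠ 0) (hr : r ≠ 0),
      (∀ i j, i ≠ j →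
          Projectivization.mk k (p i) (hp i) ≠ Projectivization.mk k (p j) (hp j)) →
      (∀ i, Projectivization.mk k (p i) (hp i) ≠ Projectivization.mk k r hr) →
      (∀ i j, eval (p i) (pderiv j F) = 0) → (∀ j, eval r (pderiv j F) = 0) →
      r ∉ Submodule.span k (Set.range p) := by
    intro p r hp hr hne hner hs hsr hmem
    have hl := htrip p hp hne hs
    apply hnofour
    have hq : ∀ i, (Fin.snoc p r : Fin 4 → (Fin 5 → k)) i ≠ 0 := by
      intro i
      refine Fin.lastCases ?_ (fun j => ?_) i
      · simpa only [Fin.snoc_last, Fin.snoc_castSucc] using hr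
      · simpa using hp j
    refine ⟨Submodule.span k (Set.range p), Fin.snoc p r, hq, ?_, ?_, ?_, ?_⟩
    · simpa using finrank_span_eq_card hl
    · intro i
      refine Fin.lastCases ?_ (fun j => ?_) i
      · simpa only [Fin.snoc_last, Fin.snoc_castSucc] using hmem
      · simpa using Submodule.subset_span (Set.mem_range_self j)
    · intro i j
      refine Fin.lastCases ?_ (fun i => ?_) i <;> refine Fin.lastCases ?_ (fun j => ?_) j
      · simp
      · intro _
        simpa only [Fin.snoc_last, Fin.snoc_castSucc] using (hner j).symm
      · intro _
        simpa only [Fin.snoc_last, Fin.snoc_castSucc] using hner i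
      · intro h
        simpa using hne i j (by simpa using h)
    · intro i
      refine Fin.lastCases ?_ (fun j => ?_) i
      · simpa only [Fin.snoc_last, Fin.snoc_castSucc] using hsr
      · simpa using hs j
  have hfour : ∀ (p : Fin 4 → (Fin 5 → k)) (hp : ∀ i, p i ≠ 0),
      (∀ i j, i ≠ j →
          Projectivization.mk k (p i) (hp i) ≠ Projectivization.mk k (p j) (hp j)) →
      (∀ i j, eval (p i) (pderiv j F) = 0) → LinearIndependent k p := by
    intro p hp hne hs
    rw [linearIndependent_finSucc']
    refine ⟨htrip _ (fun i => hp _) (fun i j hij => hne _ _ (by simpa using hij))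
      (fun i => hs _), ?_⟩
    exact hquad _ _ (fun i => hp _) (hp _) (fun i j hij => hne _ _ (by simpa using hij))
      (fun i => hne _ _ (Fin.castSucc_lt_last i).ne) (fun i => hs _) (hs _)
  intro d hd2 hd5 p hp hne hs
  suffices h : LinearIndependent k p by simpa using finrank_span_eq_card h
  interval_cases d
  · have := hpair _ _ (hp 0) (hp 1) (hne 0 1 (by decide))
    convert this using 1
    ext i; fin_cases i <;> rfl
  · exact htrip p hp hne hs
  · exact hfour p hp hne hs
  · rw [linearIndependent_finSucc']
    have hl4 : LinearIndependent k (Fin.init p) :=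
      hfour _ (fun i => hp _) (fun i j hij => hne _ _ (by simpa using hij)) (fun i => hs _)
    refine ⟨hl4, fun hmem => ?_⟩
    obtain ⟨a, h⟩ := (Submodule.mem_span_range_iff_exists_fun k).1 hmem
    have h2 := (hT (p (Fin.last 4))).1 (hs _)
    rw [← h] at h2
    refine aux_five F T h12 h23 hT hfin _ hl4 (fun i => (hT _).1 (hs _)) a (fun m hm => ?_) h2
    refine hquad (fun i => Fin.init p (m.succAbove i)) (p (Fin.last 4)) (fun i => hp _) (hp _)
      (fun i j hij => hne _ _ (by simpa using hij))
      (fun i => hne _ _ (Fin.castSucc_lt_last _).ne) (fun i => hs _) (hs _) ?_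
    rw [← h, Fin.sum_univ_succAbove _ m, hm, zero_smul, zero_add]
    exact Submodule.sum_mem _ fun i _ => Submodule.smul_mem _ _
      (Submodule.subset_span ⟨i, rfl⟩)
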